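/- arXiv:1510.07030 — 2 statements merged into one kernel-verified Lean document; each statement's English description precedes it below -/
import Mathlib

section
/- Let ρ be a law invariant risk measure whose induced divergence α is simplified. Let E and F be Polish spaces, ν ∈ 𝓟(E), and let K^ν and K^μ be kernels from E to F; set ν̄ := ν⊗K^ν ∈ 𝓟(E×F). Then, as an identity in [0,∞], ∫_E ν(dx) α(K^ν_x | K^μ_x) = sup{∫_{E×F} f dν̄ − ∫_E ν(dx) ρ_{K^μ_x}(f(x,·)) : f : E×F → ℝ bounded measurable}. -/
open MeasureTheory ProbabilityTheory Filter Topology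
open scoped ENNReal NNReal

noncomputable section

namespace RiskDiv

/-- A bounded measurable real-valued function (a representative of an element of `L^∞`). -/
def BddMeas {E : Type*} [MeasurableSpace E] (f : E → ℝ) : Prop :=
  Measurable f ∧ ∃ M : ℝ, ∀ x, |f x| ≤ M

/-- A (normalized, convex, monotone, cash-additive) risk measure on `L^∞(E, μ)`,
viewed as a functional on bounded measurable functions which respects a.e. equality. -/
structure IsRiskMeasure {E : Type*} [MeasurableSpace E] (μ : Measure E)
    (ρ : (E → ℝ) → ℝ) : Prop where
  mono : ∀ f g : E → ℝ, BddMeas f → BddMeas g → (∀ᵐ x ∂μ, f x ≤ g x) → ρ f ≤ ρ g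
  cash : ∀ (f : E → ℝ) (c : ℝ), BddMeas f → ρ (fun x => f x + c) = ρ f + c
  norm0 : ρ (fun _ => 0) = 0
  cvx : ∀ (f g : E → ℝ) (t : ℝ), BddMeas f → BddMeas g → 0 ≤ t → t ≤ 1 →
    ρ (fun x => t * f x + (1 - t) * g x) ≤ t * ρ f + (1 - t) * ρ g
  congr_ae : ∀ f g : E → ℝ, BddMeas f → BddMeas g → (∀ᵐ x ∂μ, f x = g x) → ρ f = ρ g

/-- Law invariance: `ρ` only depends on the distribution of its argument. -/
def LawInvariant {E : Type*} [MeasurableSpace E] (μ : Measure E) (ρ : (E → ℝ) → ℝ) : Prop :=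
  ∀ f g : E → ℝ, BddMeas f → BddMeas g → μ.map f = μ.map g → ρ f = ρ g

open Classical in
/-- `ρ_μ(f) := ρ(f ∘ X)` where `X` is any random variable with law `μ` (this is well defined,
independently of the choice of `X`, when `ρ` is law invariant). -/
def rhoMu {Ω : Type*} [MeasurableSpace Ω] (P : Measure Ω) (ρ : (Ω → ℝ) → ℝ)
    {E : Type*} [MeasurableSpace E] (μ : Measure E) (f : E → ℝ) : ℝ :=
  if h : ∃ X : Ω → E, Measurable X ∧ P.map X = μ then ρ (f ∘ h.choose) else 0

/-- The divergence induced by `ρ`: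
`α(ν|μ) := sup { ∫ f dν − ρ_μ(f) : f bounded measurable } ∈ [0,∞]`. -/
def divergence {Ω : Type*} [MeasurableSpace Ω] (P : Measure Ω) (ρ : (Ω → ℝ) → ℝ)
    {E : Type*} [MeasurableSpace E] (ν μ : Measure E) : ℝ≥0∞ :=
  ⨆ (f : E → ℝ) (_ : BddMeas f), ENNReal.ofReal ((∫ x, f x ∂ν) - rhoMu P ρ μ f)

/-- The divergence induced by `ρ` is simplified if, on `[0,1]`, the supremum defining it can be
restricted to continuous functions. -/
def Simplified {Ω : Type*} [MeasurableSpace Ω] (P : Measure Ω) (ρ : (Ω → ℝ) → ℝ) : Prop :=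
  ∀ μ ν : Measure (Set.Icc (0:ℝ) 1), IsProbabilityMeasure μ → IsProbabilityMeasure ν →
    divergence P ρ ν μ =
      ⨆ (f : (Set.Icc (0:ℝ) 1) → ℝ) (_ : Continuous f),
        ENNReal.ofReal ((∫ x, f x ∂ν) - rhoMu P ρ μ f)

theorem exists_uniform {Ω : Type*} [MeasurableSpace Ω] [StandardBorelSpace Ω]
    (P : Measure Ω) [IsProbabilityMeasure P] [NullSingletonClass P] :
    ∃ U : Ω → unitInterval, Measurable U ∧ P.map U = volume := by
  have he := measurableEmbedding_embeddingReal Ω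
  set m : Measure ℝ := P.map (embeddingReal Ω) with hm
  have : IsProbabilityMeasure m := Measure.isProbabilityMeasure_map he.measurable.aemeasurable
  have hatom : ∀ a, m {a} = 0 := by
    intro a
    rw [hm, he.map_apply]
    apply Set.Subsingleton.measure_zero
    intro x hx y hy
    apply he.injective
    simp only [Set.mem_preimage, Set.mem_singleton_iff] at hx hy
    rw [hx, hy]
  have hcont : Continuous (cdf m) := by
    rw [continuous_iff_continuousAt]
    intro a
    rw [(monotone_cdf m).continuousAt_iff_leftLim_eq_rightLim, StieltjesFunction.rightLim_eq]
    have h1 := (cdf m).measure_singleton a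
    rw [measure_cdf, hatom] at h1
    have h2 := ENNReal.ofReal_eq_zero.1 h1.symm
    have h3 := (monotone_cdf m).leftLim_le (le_refl a)
    linarith
  have hrange : ∀ y : ℝ, 0 < y → y < 1 → ∃ s, cdf m s = y := by
    intro y h0 h1
    have := mem_range_of_exists_le_of_exists_ge hcont (c := y)
      (((tendsto_cdf_atBot m).eventually_le_const h0).exists)
      (((tendsto_cdf_atTop m).eventually_const_le h1).exists)
    exact this
  let G : ℝ → unitInterval := fun t => ⟨cdf m t, cdf_nonneg m t, cdf_le_one m t⟩
  have hG : Measurable G := (hcont.subtype_mk _).measurable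
  have hGm : m.map G = volume := by
    have : IsProbabilityMeasure (m.map G) := Measure.isProbabilityMeasure_map hG.aemeasurable
    apply Measure.ext_of_Iic
    intro x
    rw [Measure.map_apply hG measurableSet_Iic, unitInterval.volume_Iic]
    have hset : G ⁻¹' Set.Iic x = {t | cdf m t ≤ x} := by
      ext t; simp [G, ← Subtype.coe_le_coe]
    rw [hset]
    rcases eq_or_lt_of_le x.2.2 with h1 | h1
    · rw [h1]
      have : {t | cdf m t ≤ 1} = Set.univ := by ext t; simp [cdf_le_one]
      rw [this]; simp
    apply le_antisymm
    · have key : ∀ y : ℝ, (x : ℝ) < y → y < 1 → m {t | cdf m t ≤ x} ≤ ENNReal.ofReal y := by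
        intro y hy hy1
        obtain ⟨s, hs⟩ := hrange y (lt_of_le_of_lt x.2.1 hy) hy1
        rw [← hs, ofReal_cdf]
        apply measure_mono
        intro t ht
        simp only [Set.mem_ofPred_eq, Set.mem_Iic] at ht ⊢
        by_contra hlt
        push Not at hlt
        have := monotone_cdf m hlt.le
        linarith
      have hlim : Tendsto (fun y : ℝ => ENNReal.ofReal y) (𝓝[>] (x : ℝ)) (𝓝 (ENNReal.ofReal x)) :=
        (ENNReal.continuous_ofReal.tendsto _).mono_left nhdsWithin_le_nhds
      apply ge_of_tendsto hlim
      filter_upwards [Ioo_mem_nhdsGT h1] with y hy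
      exact key y hy.1 hy.2
    · rcases eq_or_lt_of_le x.2.1 with h0 | h0
      · rw [← h0]; simp
      obtain ⟨s, hs⟩ := hrange x h0 h1
      conv_lhs => rw [← hs, ofReal_cdf]
      apply measure_mono
      intro t ht
      simp only [Set.mem_ofPred_eq, Set.mem_Iic] at ht ⊢
      rw [← hs]; exact monotone_cdf m ht
  refine ⟨G ∘ embeddingReal Ω, hG.comp he.measurable, ?_⟩
  rw [← Measure.map_map hG he.measurable]
  exact hGm

theorem exists_rv {Ω : Type*} [MeasurableSpace Ω] [StandardBorelSpace Ω]
    (P : Measure Ω) [IsProbabilityMeasure P] [NullSingletonClass P]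
    {S : Type*} [MeasurableSpace S] [StandardBorelSpace S]
    (μ : Measure S) [IsProbabilityMeasure μ] :
    ∃ X : Ω → S, Measurable X ∧ P.map X = μ := by
  have : Nonempty S := nonempty_of_isProbabilityMeasure μ
  obtain ⟨U, hU, hUm⟩ := exists_uniform P
  obtain ⟨f, hf, hfm⟩ := Measure.exists_measurable_map_eq μ
  exact ⟨f ∘ U, hf.comp hU, by rw [← Measure.map_map hf hU, hUm, hfm]⟩

theorem BddMeas.comp {S T : Type*} [MeasurableSpace S] [MeasurableSpace T] {f : S → ℝ}
    (hf : BddMeas f) {X : T → S} (hX : Measurable X) : BddMeas (f ∘ X) :=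
  ⟨hf.1.comp hX, hf.2.imp fun _ h x => h (X x)⟩

set_option linter.unusedSectionVars false

section
variable {Ω : Type*} [MeasurableSpace Ω] [StandardBorelSpace Ω]
    {P : Measure Ω} [IsProbabilityMeasure P] [NullSingletonClass P]
    {ρ : (Ω → ℝ) → ℝ}

theorem rhoMu_eq (hLI : LawInvariant P ρ)
    {S : Type*} [MeasurableSpace S] {X : Ω → S} (hX : Measurable X)
    {f : S → ℝ} (hf : BddMeas f) : rhoMu P ρ (P.map X) f = ρ (f ∘ X) := by
  have h : ∃ Y : Ω → S, Measurable Y ∧ P.map Y = P.map X := ⟨X, hX, rfl⟩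
  unfold rhoMu
  rw [dif_pos h]
  apply hLI _ _ (hf.comp h.choose_spec.1) (hf.comp hX)
  rw [← Measure.map_map hf.1 h.choose_spec.1, ← Measure.map_map hf.1 hX, h.choose_spec.2]

theorem rhoMu_comp (hLI : LawInvariant P ρ)
    {S T : Type*} [MeasurableSpace S] [StandardBorelSpace S] [MeasurableSpace T]
    (μ : Measure S) [IsProbabilityMeasure μ] {g : S → T} (hg : Measurable g)
    {f : T → ℝ} (hf : BddMeas f) : rhoMu P ρ (μ.map g) f = rhoMu P ρ μ (f ∘ g) := by
  obtain ⟨X, hX, rfl⟩ := exists_rv P μ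
  rw [Measure.map_map hg hX, rhoMu_eq hLI (hg.comp hX) hf, rhoMu_eq hLI hX (hf.comp hg)]
  rfl

theorem rhoMu_le_add (hρ : IsRiskMeasure P ρ) (hLI : LawInvariant P ρ)
    {S : Type*} [MeasurableSpace S] [StandardBorelSpace S]
    (μ : Measure S) [IsProbabilityMeasure μ] {f g : S → ℝ} (hf : BddMeas f) (hg : BddMeas g)
    {ε : ℝ} (h : ∀ x, f x ≤ g x + ε) : rhoMu P ρ μ f ≤ rhoMu P ρ μ g + ε := by
  obtain ⟨X, hX, rfl⟩ := exists_rv P μ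
  rw [rhoMu_eq hLI hX hf, rhoMu_eq hLI hX hg, ← hρ.cash _ _ (hg.comp hX)]
  apply hρ.mono _ _ (hf.comp hX)
  · refine ⟨(hg.comp hX).1.add_const _, ?_⟩
    obtain ⟨M, hM⟩ := hg.2
    exact ⟨M + |ε|, fun x => (abs_add_le _ _).trans (by have := hM (X x); simp; exact this)⟩
  · exact Eventually.of_forall fun x => h (X x)

theorem rhoMu_zero (hρ : IsRiskMeasure P ρ) (hLI : LawInvariant P ρ)
    {S : Type*} [MeasurableSpace S] [StandardBorelSpace S]
    (μ : Measure S) [IsProbabilityMeasure μ] : rhoMu P ρ μ (fun _ => 0) = 0 := by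
  obtain ⟨X, hX, rfl⟩ := exists_rv P μ
  rw [rhoMu_eq hLI hX ⟨measurable_const, 0, by simp⟩]
  exact hρ.norm0

theorem abs_rhoMu_le (hρ : IsRiskMeasure P ρ) (hLI : LawInvariant P ρ)
    {S : Type*} [MeasurableSpace S] [StandardBorelSpace S]
    (μ : Measure S) [IsProbabilityMeasure μ] {f : S → ℝ} (hf : BddMeas f)
    {M : ℝ} (h : ∀ x, |f x| ≤ M) : |rhoMu P ρ μ f| ≤ M := by
  have h0 : BddMeas (fun _ : S => (0 : ℝ)) := ⟨measurable_const, 0, by simp⟩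
  have h1 := rhoMu_le_add hρ hLI μ hf h0 (ε := M) (fun x => by have := (abs_le.1 (h x)).2; linarith)
  have h2 := rhoMu_le_add hρ hLI μ h0 hf (ε := M) (fun x => by have := (abs_le.1 (h x)).1; linarith)
  rw [rhoMu_zero hρ hLI] at h1 h2
  rw [abs_le]; constructor <;> linarith

theorem sum_ite_smul {A : Type*} [AddCommMonoid A] (n : ℕ) (j : Fin (n + 1)) (x y : A) :
    ∑ u : Fin (n + 1), (if u = j then x else y) = x + n • y := by
  rw [← Finset.add_sum_erase _ _ (Finset.mem_univ j)]
  congr 1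
  · simp
  · rw [Finset.sum_congr rfl (g := fun _ => y)]
    · simp
    · intro u hu; simp [Finset.ne_of_mem_erase hu]

/-- The joint law used for mixing. -/
def mixLaw (n : ℕ) {T : Type*} [MeasurableSpace T] (τ : Measure T) : Measure (Fin (n + 1) × T) :=
  ((n : ℝ≥0∞) + 1)⁻¹ • ∑ j : Fin (n + 1), τ.map (Prod.mk j)

theorem mixLaw_map (n : ℕ) {T S : Type*} [MeasurableSpace T] [MeasurableSpace S] (τ : Measure T)
    {h : Fin (n + 1) × T → S} (hh : Measurable h) :
    (mixLaw n τ).map h = ((n : ℝ≥0∞) + 1)⁻¹ • ∑ j : Fin (n + 1), τ.map (fun z => h (j, z)) := by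
  unfold mixLaw
  rw [Measure.map_smul, Measure.map_finset_sum hh.aemeasurable]
  congr 1
  refine Finset.sum_congr rfl fun j _ => ?_
  rw [Measure.map_map hh measurable_prodMk_left]
  rfl

instance (n : ℕ) {T : Type*} [MeasurableSpace T] (τ : Measure T) [IsProbabilityMeasure τ] :
    IsProbabilityMeasure (mixLaw n τ) := by
  constructor
  unfold mixLaw
  have : ∀ j : Fin (n + 1), (τ.map (Prod.mk j)) Set.univ = 1 := by
    intro j
    rw [Measure.map_apply measurable_prodMk_left MeasurableSet.univ]; simp
  simp only [Measure.smul_apply, Measure.coe_finsetSum, Finset.sum_apply, this]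
  simp only [Finset.sum_const, Finset.card_univ, Fintype.card_fin, smul_eq_mul, nsmul_eq_mul,
    mul_one]
  push_cast
  exact ENNReal.inv_mul_cancel (by simp) (by simp)

theorem rho_convexOn (hρ : IsRiskMeasure P ρ) : ConvexOn ℝ {f : Ω → ℝ | BddMeas f} ρ := by
  constructor
  · intro f hf g hg s t _ _ _
    obtain ⟨M, hM⟩ := hf.2
    obtain ⟨N, hN⟩ := hg.2
    refine ⟨(hf.1.const_smul s).add (hg.1.const_smul t), |s| * M + |t| * N, fun x => ?_⟩
    refine (abs_add_le _ _).trans ?_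
    simp only [Pi.smul_apply, smul_eq_mul, abs_mul]
    gcongr
    · exact hM x
    · exact hN x
  · intro f hf g hg s t hs ht hst
    have h := hρ.cvx f g s hf hg hs (by linarith)
    have : t = 1 - s := by linarith
    subst this
    exact h

theorem rhoMu_mix (hρ : IsRiskMeasure P ρ) (hLI : LawInvariant P ρ)
    {S : Type*} [MeasurableSpace S] [StandardBorelSpace S]
    (μ η : Measure S) [IsProbabilityMeasure μ] [IsProbabilityMeasure η]
    {a : S → ℝ} (ha : BddMeas a) {M : ℝ} (hM : ∀ x, |a x| ≤ M) (n : ℕ) :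
    rhoMu P ρ μ a - 2 * M / (n + 1) ≤
      rhoMu P ρ (((n : ℝ≥0∞) + 1)⁻¹ • (η + n • μ)) a := by
  have : Nonempty S := nonempty_of_isProbabilityMeasure μ
  have hM0 : 0 ≤ M := (abs_nonneg _).trans (hM (Classical.arbitrary S))
  obtain ⟨W, hW, hWm⟩ := exists_rv P (mixLaw n (μ.prod η))
  let f : Fin (n + 1) → Fin (n + 1) × (S × S) → ℝ := fun j w =>
    if w.1 = j then a w.2.1 - 2 * M else a w.2.1
  have hfm : ∀ j, BddMeas (f j) := by
    intro j
    refine ⟨?_, 3 * M, ?_⟩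
    · refine Measurable.ite (measurable_fst (measurableSet_singleton j)) ?_ ?_
      · exact (ha.1.comp (measurable_fst.comp measurable_snd)).sub_const _
      · exact (ha.1.comp (measurable_fst.comp measurable_snd))
    · intro w
      have := abs_le.1 (hM w.2.1)
      simp only [f]
      split_ifs <;> rw [abs_le] <;> constructor <;> linarith
  have hlaw : ∀ j, ρ (f j ∘ W) = ρ (f 0 ∘ W) := by
    intro j
    apply hLI _ _ ((hfm j).comp hW) ((hfm 0).comp hW)
    have key : ∀ j, P.map (f j ∘ W) = ((n : ℝ≥0∞) + 1)⁻¹ •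
        ((μ.prod η).map (fun z => a z.1 - 2 * M) + n • (μ.prod η).map (fun z => a z.1)) := by
      intro j
      rw [← Measure.map_map (hfm j).1 hW, hWm, mixLaw_map _ _ (hfm j).1, ← sum_ite_smul n j]
      congr 1
      refine Finset.sum_congr rfl fun u _ => ?_
      split_ifs with h <;> simp [f, h]
    rw [key, key]
  let Y : Fin (n + 1) × (S × S) → S := fun w => if w.1 = 0 then w.2.2 else w.2.1
  have hY : Measurable Y := Measurable.ite (measurable_fst (measurableSet_singleton 0))
    (measurable_snd.comp measurable_snd) (measurable_fst.comp measurable_snd)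
  have hYlaw : P.map (Y ∘ W) = ((n : ℝ≥0∞) + 1)⁻¹ • (η + n • μ) := by
    rw [← Measure.map_map hY hW, hWm, mixLaw_map _ _ hY, ← sum_ite_smul n 0]
    congr 1
    refine Finset.sum_congr rfl fun u _ => ?_
    split_ifs with h
    · simp only [Y, h, if_true]
      exact measurePreserving_snd.map_eq
    · simp only [Y, h, if_false]
      exact measurePreserving_fst.map_eq
  have hZ : Measurable (fun w : Fin (n + 1) × (S × S) => w.2.1) :=
    measurable_fst.comp measurable_snd
  have hZlaw : P.map ((fun w : Fin (n + 1) × (S × S) => w.2.1) ∘ W) = μ := by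
    rw [← Measure.map_map hZ hW, hWm, mixLaw_map _ _ hZ]
    have : (μ.prod η).map (fun z => z.1) = μ := measurePreserving_fst.map_eq
    simp only [this, Finset.sum_const, Finset.card_univ, Fintype.card_fin]
    rw [← Nat.cast_smul_eq_nsmul ℝ≥0∞, smul_smul]
    push_cast
    rw [ENNReal.inv_mul_cancel (by simp) (by simp), one_smul]
  rw [← hYlaw, rhoMu_eq hLI (hY.comp hW) ha]
  have e1 : rhoMu P ρ μ a = ρ (a ∘ ((fun w : Fin (n + 1) × (S × S) => w.2.1) ∘ W)) := by
    conv_lhs => rw [← hZlaw]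
    rw [rhoMu_eq hLI (hZ.comp hW) ha]
  have hle : ρ (f 0 ∘ W) ≤ ρ (a ∘ (Y ∘ W)) := by
    apply hρ.mono _ _ ((hfm 0).comp hW) (ha.comp (hY.comp hW))
    refine Eventually.of_forall fun ω => ?_
    simp only [f, Y, Function.comp]
    have h1 := abs_le.1 (hM (W ω).2.1)
    have h2 := abs_le.1 (hM (W ω).2.2)
    split_ifs <;> linarith
  have hn : (0 : ℝ) < (n : ℝ) + 1 := by positivity
  have hJ := (rho_convexOn hρ).map_sum_le (t := Finset.univ) (w := fun _ : Fin (n + 1) =>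
    ((n : ℝ) + 1)⁻¹) (p := fun j => f j ∘ W) (fun _ _ => by positivity)
    (by simp; field_simp) (fun j _ => (hfm j).comp hW)
  simp only [hlaw, Finset.sum_const, Finset.card_univ, Fintype.card_fin, smul_eq_mul,
    nsmul_eq_mul] at hJ
  push_cast at hJ
  rw [mul_inv_cancel_left₀ hn.ne'] at hJ
  have havg : (∑ i : Fin (n + 1), ((n : ℝ) + 1)⁻¹ • (f i ∘ W)) =
      fun ω => (a ∘ ((fun w : Fin (n + 1) × (S × S) => w.2.1) ∘ W)) ω + (- (2 * M / (n + 1))) := by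
    funext ω
    simp only [Finset.sum_apply, Pi.smul_apply, Function.comp, smul_eq_mul, f]
    rw [← Finset.mul_sum]
    have : ∀ i : Fin (n + 1), (if (W ω).1 = i then a (W ω).2.1 - 2 * M else a (W ω).2.1) =
      (if i = (W ω).1 then a (W ω).2.1 - 2 * M else a (W ω).2.1) := by
      intro i; simp only [eq_comm]
    simp only [this, sum_ite_smul, nsmul_eq_mul]
    field_simp
    ring
  rw [havg, hρ.cash _ _ (ha.comp (hZ.comp hW)), ← e1] at hJ
  linarith
theorem rhoMu_lsc_fin (hρ : IsRiskMeasure P ρ) (hLI : LawInvariant P ρ)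
    {N : ℕ} (μ μ' : Measure (Fin N)) [IsProbabilityMeasure μ] [IsProbabilityMeasure μ']
    {a : Fin N → ℝ} (ha : BddMeas a) {M : ℝ} (hM : ∀ x, |a x| ≤ M) (n : ℕ)
    (h : ∀ i, ((n : ℝ≥0∞) + 1)⁻¹ * n * μ {i} ≤ μ' {i}) :
    rhoMu P ρ μ a - 2 * M / (n + 1) ≤ rhoMu P ρ μ' a := by
  set c : ℝ≥0∞ := ((n : ℝ≥0∞) + 1)⁻¹ with hc
  have hc1 : ((n : ℝ≥0∞) + 1) * c = 1 := ENNReal.mul_inv_cancel (by simp) (by simp)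
  have hc1' : c * ((n : ℝ≥0∞) + 1) = 1 := by rw [mul_comm]; exact hc1
  have hcn : c * n + c = 1 := by rw [← hc1]; ring
  have hctop : c * n ≠ ∞ := by
    intro h; rw [h] at hcn; simp at hcn
  have hle : (c * n) • μ ≤ μ' := by
    rw [Measure.le_iff]
    intro s _
    have e : ∀ τ : Measure (Fin N), τ s = ∑ i ∈ s.toFinite.toFinset, τ {i} := by
      intro τ
      rw [sum_measure_singleton]; simp
    rw [Measure.smul_apply, e μ, e μ', smul_eq_mul, Finset.mul_sum]
    exact Finset.sum_le_sum fun i _ => h i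
  have hfin : IsFiniteMeasure ((c * n) • μ) := ⟨by simp [lt_top_iff_ne_top, hctop]⟩
  have hsub := Measure.sub_add_cancel_of_le hle
  let η : Measure (Fin N) := ((n : ℝ≥0∞) + 1) • (μ' - (c * n) • μ)
  have hcη : c • η = μ' - (c * n) • μ := by
    simp only [η]; rw [smul_smul, hc1', one_smul]
  have hmix : c • (η + n • μ) = μ' := by
    rw [smul_add, hcη, ← Nat.cast_smul_eq_nsmul ℝ≥0∞, smul_smul, hsub]
  have hη : IsProbabilityMeasure η := by
    constructor
    have h1 : (c • (η + n • μ)) Set.univ = 1 := by rw [hmix]; simp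
    simp only [Measure.smul_apply, Measure.add_apply, smul_eq_mul, measure_univ,
      nsmul_eq_mul, mul_one, mul_add] at h1
    rw [add_comm] at h1
    have h2 : c * η Set.univ = c := by
      rw [← hcn] at h1
      exact (ENNReal.add_right_inj hctop).1 h1
    calc η Set.univ = ((n : ℝ≥0∞) + 1) * (c * η Set.univ) := by rw [← mul_assoc, hc1, one_mul]
      _ = 1 := by rw [h2, hc1]
  have := rhoMu_mix hρ hLI μ η ha hM n
  rwa [← hc, hmix] at this

theorem measurable_rhoMu_fin (hρ : IsRiskMeasure P ρ) (hLI : LawInvariant P ρ)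
    {E : Type*} [MeasurableSpace E] {N : ℕ} (κ : Kernel E (Fin N)) [IsMarkovKernel κ]
    (a : Fin N → ℝ) : Measurable (fun x => rhoMu P ρ (κ x) a) := by
  have hM : ∀ x, |a x| ≤ ∑ i, |a i| := fun x =>
    Finset.single_le_sum (f := fun i => |a i|) (fun i _ => abs_nonneg _) (Finset.mem_univ x)
  set M := ∑ i, |a i| with hMdef
  have ha : BddMeas a := ⟨measurable_of_finite a, M, hM⟩
  let p : E → Fin N → ℝ≥0∞ := fun x i => κ x {i}
  have hp : Measurable p := measurable_pi_lambda _ fun i => κ.measurable_coe (measurableSet_singleton i)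
  refine measurable_of_Ioi fun c => ?_
  have key : ∀ x, c < rhoMu P ρ (κ x) a → ∃ U : Set (Fin N → ℝ≥0∞), IsOpen U ∧ p x ∈ U ∧
      ∀ y, p y ∈ U → c < rhoMu P ρ (κ y) a := by
    intro x hx
    obtain ⟨n, hn⟩ : ∃ n : ℕ, 2 * M / (n + 1) < rhoMu P ρ (κ x) a - c := by
      have h1 : Tendsto (fun n : ℕ => 2 * M * (1 / ((n : ℝ) + 1))) atTop (𝓝 (2 * M * 0)) :=
        tendsto_one_div_add_atTop_nhds_zero_nat.const_mul _
      rw [mul_zero] at h1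
      obtain ⟨n, hn⟩ := (h1.eventually_lt_const (sub_pos.2 hx)).exists
      exact ⟨n, by rw [← mul_one_div]; exact hn⟩
    refine ⟨⋂ i : {i // p x i ≠ 0}, {q | ((n : ℝ≥0∞) + 1)⁻¹ * n * p x i < q i}, ?_, ?_, ?_⟩
    · exact isOpen_iInter_of_finite fun i => isOpen_lt continuous_const (continuous_apply _)
    · simp only [Set.mem_iInter, Set.mem_ofPred_eq]
      rintro ⟨i, hi⟩
      have h1 : ((n : ℝ≥0∞) + 1)⁻¹ * n < 1 := by
        rw [mul_comm, ← div_eq_mul_inv]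
        apply ENNReal.div_lt_of_lt_mul
        rw [one_mul]
        exact_mod_cast Nat.lt_succ_self n
      have := ENNReal.mul_lt_mul_left hi (measure_ne_top (κ x) {i}) h1
      simpa [p] using this
    · intro y hy
      simp only [Set.mem_iInter, Set.mem_ofPred_eq] at hy
      have := rhoMu_lsc_fin hρ hLI (κ x) (κ y) ha hM n (fun i => by
        by_cases hi : p x i = 0
        · change _ * p x i ≤ _
          rw [hi]; simp
        · exact (hy ⟨i, hi⟩).le)
      linarith
  have : (fun x => rhoMu P ρ (κ x) a) ⁻¹' Set.Ioi c =
      p ⁻¹' (⋃₀ {U | IsOpen U ∧ ∀ y, p y ∈ U → c < rhoMu P ρ (κ y) a}) := by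
    ext x
    simp only [Set.mem_preimage, Set.mem_Ioi, Set.mem_sUnion, Set.mem_ofPred_eq]
    constructor
    · intro hx
      obtain ⟨U, h1, h2, h3⟩ := key x hx
      exact ⟨U, ⟨h1, h3⟩, h2⟩
    · rintro ⟨U, ⟨_, h⟩, hxU⟩
      exact h x hxU
  rw [this]
  exact hp (isOpen_sUnion fun U hU => hU.1).measurableSet

theorem BddMeas.slice {E F : Type*} [MeasurableSpace E] [MeasurableSpace F] {f : E × F → ℝ}
    (hf : BddMeas f) (x : E) : BddMeas (fun y => f (x, y)) := hf.comp measurable_prodMk_left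

theorem measurable_rhoMu (hρ : IsRiskMeasure P ρ) (hLI : LawInvariant P ρ)
    {E F : Type*} [MeasurableSpace E] [MeasurableSpace F] [StandardBorelSpace F]
    (K : Kernel E F) [IsMarkovKernel K] {f : E × F → ℝ} (hf : BddMeas f) :
    Measurable (fun x => rhoMu P ρ (K x) (fun y => f (x, y))) := by
  obtain ⟨M, hM⟩ := hf.2
  let L : ℕ → ℕ := fun n => ⌈((n : ℝ) + 1) * (2 * M)⌉₊
  let I : (n : ℕ) → E × F → Fin (L n + 1) := fun n p =>
    Fin.ofNat (L n + 1) ⌊((n : ℝ) + 1) * (f p + M)⌋₊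
  let a : (n : ℕ) → Fin (L n + 1) → ℝ := fun n i => (i : ℕ) / ((n : ℝ) + 1) - M
  have hI : ∀ n, Measurable (I n) := by
    intro n
    have h1 : Measurable (fun p => ⌊((n : ℝ) + 1) * (f p + M)⌋₊) :=
      Nat.measurable_floor.comp ((hf.1.add_const M).const_mul _)
    exact (measurable_of_countable (Fin.ofNat (L n + 1))).comp h1
  have ha : ∀ n, BddMeas (a n) := fun n => ⟨measurable_of_finite _, ∑ i, |a n i|, fun x =>
    Finset.single_le_sum (f := fun i => |a n i|) (fun i _ => abs_nonneg _) (Finset.mem_univ x)⟩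
  have happ : ∀ n p, a n (I n p) ≤ f p ∧ f p ≤ a n (I n p) + 1 / ((n : ℝ) + 1) := by
    intro n p
    have hn : (0 : ℝ) < (n : ℝ) + 1 := by positivity
    have hb := abs_le.1 (hM p)
    have h0 : 0 ≤ ((n : ℝ) + 1) * (f p + M) := mul_nonneg hn.le (by linarith)
    have h1 : ⌊((n : ℝ) + 1) * (f p + M)⌋₊ < L n + 1 := by
      rw [Nat.lt_succ_iff]
      refine (Nat.floor_le_floor ?_).trans (Nat.floor_le_ceil (((n : ℝ) + 1) * (2 * M)))
      gcongr
      linarith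
    have h2 : ((I n p : Fin (L n + 1)) : ℕ) = ⌊((n : ℝ) + 1) * (f p + M)⌋₊ := by
      simp only [I, Fin.ofNat]
      exact Nat.mod_eq_of_lt h1
    have h3 := Nat.floor_le h0
    have h4 := Nat.lt_floor_add_one (((n : ℝ) + 1) * (f p + M))
    simp only [a, h2]
    constructor
    · rw [sub_le_iff_le_add, div_le_iff₀ hn]; linarith
    · have : f p + M ≤ (⌊((n : ℝ) + 1) * (f p + M)⌋₊ + 1) / ((n : ℝ) + 1) := by
        rw [le_div_iff₀ hn]; linarith
      rw [add_div] at this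
      linarith
  refine measurable_of_tendsto_metrizable (f := fun n x =>
    rhoMu P ρ (K x) (fun y => a n (I n (x, y)))) (fun n => ?_) ?_
  · have : IsMarkovKernel ((Kernel.id ×ₖ K).map (I n)) := Kernel.IsMarkovKernel.map _ (hI n)
    have hk := measurable_rhoMu_fin hρ hLI ((Kernel.id ×ₖ K).map (I n)) (a n)
    convert hk using 2 with x
    rw [Kernel.map_apply _ (hI n), Kernel.prod_apply, Kernel.id_apply, Measure.dirac_prod,
      Measure.map_map (hI n) measurable_prodMk_left, rhoMu_comp hLI _
        ((hI n).comp measurable_prodMk_left) (ha n)]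
    rfl
  · rw [tendsto_pi_nhds]
    intro x
    rw [tendsto_iff_dist_tendsto_zero]
    refine squeeze_zero (fun _ => dist_nonneg) (fun n => ?_)
      tendsto_one_div_add_atTop_nhds_zero_nat
    have hb : BddMeas (fun y => a n (I n (x, y))) :=
      (ha n).comp ((hI n).comp measurable_prodMk_left)
    have h1 := rhoMu_le_add hρ hLI (K x) hb (hf.slice x) (ε := 0)
      (fun y => by have := (happ n (x, y)).1; linarith)
    have h2 := rhoMu_le_add hρ hLI (K x) (hf.slice x) hb (ε := 1 / ((n : ℝ) + 1))
      (fun y => (happ n (x, y)).2)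
    have : (0 : ℝ) < 1 / ((n : ℝ) + 1) := by positivity
    rw [Real.dist_eq, abs_le]
    constructor <;> linarith

theorem exists_countable_family (hρ : IsRiskMeasure P ρ) (hLI : LawInvariant P ρ)
    (hSimp : Simplified P ρ) (F : Type*) [MeasurableSpace F] [StandardBorelSpace F] :
    ∃ h : ℕ → F → ℝ, h 0 = (fun _ => 0) ∧ (∀ n, BddMeas (h n)) ∧
      ∀ ν μ : Measure F, IsProbabilityMeasure ν → IsProbabilityMeasure μ →
        divergence P ρ ν μ = ⨆ n, ENNReal.ofReal ((∫ x, h n x ∂ν) - rhoMu P ρ μ (h n)) := by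
  obtain ⟨ι, hι⟩ : ∃ ι : F → Set.Icc (0 : ℝ) 1, MeasurableEmbedding ι :=
    ⟨_, measurableEmbedding_sigmoid_comp_embeddingReal F⟩
  let d := TopologicalSpace.denseSeq C(Set.Icc (0 : ℝ) 1, ℝ)
  have hC : ∀ φ : C(Set.Icc (0 : ℝ) 1, ℝ), BddMeas φ := fun φ =>
    ⟨φ.continuous.measurable, ‖φ‖, fun x => φ.norm_coe_le_norm x⟩
  let h : ℕ → F → ℝ := fun n => Nat.casesOn n (fun _ => 0) (fun n => d n ∘ ι)
  have hh : ∀ n, BddMeas (h n) := by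
    intro n
    cases n with
    | zero => exact ⟨measurable_const, 0, by simp [h]⟩
    | succ n => exact (hC (d n)).comp hι.measurable
  refine ⟨h, rfl, hh, fun ν μ hν hμ => le_antisymm ?_ ?_⟩
  · refine iSup₂_le fun f hf => ?_
    have hν' : IsProbabilityMeasure (ν.map ι) :=
      Measure.isProbabilityMeasure_map hι.measurable.aemeasurable
    have hμ' : IsProbabilityMeasure (μ.map ι) :=
      Measure.isProbabilityMeasure_map hι.measurable.aemeasurable
    let g : Set.Icc (0 : ℝ) 1 → ℝ := Function.extend ι f (fun _ => 0)
    have hgι : g ∘ ι = f := by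
      funext x; exact hι.injective.extend_apply f (fun _ => 0) x
    have hg : BddMeas g := by
      refine ⟨hι.measurable_extend hf.1 measurable_const, ?_⟩
      obtain ⟨M, hM⟩ := hf.2
      refine ⟨max M 0, fun y => ?_⟩
      by_cases hy : ∃ x, ι x = y
      · obtain ⟨x, rfl⟩ := hy
        have : g (ι x) = f x := congrFun hgι x
        rw [this]; exact (hM x).trans (le_max_left _ _)
      · simp only [g]
        rw [Function.extend_apply' _ _ _ hy]; simp
    have e1 : ∫ x, f x ∂ν = ∫ y, g y ∂(ν.map ι) := by
      rw [hι.integral_map]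
      exact congrArg (fun u : F → ℝ => ∫ x, u x ∂ν) hgι.symm
    have e2 : rhoMu P ρ μ f = rhoMu P ρ (μ.map ι) g := by
      rw [rhoMu_comp hLI μ hι.measurable hg, hgι]
    rw [e1, e2]
    refine (le_iSup₂_of_le (f := fun (g : Set.Icc (0 : ℝ) 1 → ℝ) (_ : BddMeas g) =>
      ENNReal.ofReal ((∫ x, g x ∂(ν.map ι)) - rhoMu P ρ (μ.map ι) g)) g hg le_rfl).trans ?_
    change divergence P ρ (ν.map ι) (μ.map ι) ≤ _
    rw [hSimp _ _ hμ' hν']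
    refine iSup₂_le fun φ' hφ' => ?_
    let φ : C(Set.Icc (0 : ℝ) 1, ℝ) := ⟨φ', hφ'⟩
    change ENNReal.ofReal ((∫ x, φ x ∂(ν.map ι)) - rhoMu P ρ (μ.map ι) φ) ≤ _
    refine ENNReal.le_of_forall_pos_le_add fun ε hε _ => ?_
    have hε2 : (0 : ℝ) < ε / 2 := by positivity
    obtain ⟨n, hn⟩ := (TopologicalSpace.denseRange_denseSeq
      C(Set.Icc (0 : ℝ) 1, ℝ)).exists_dist_lt φ hε2
    have hpt : ∀ x, |φ x - d n x| ≤ ε / 2 := fun x =>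
      (ContinuousMap.dist_apply_le_dist x).trans hn.le
    have hInt : ∀ ψ : C(Set.Icc (0 : ℝ) 1, ℝ), Integrable ψ (ν.map ι) := fun ψ =>
      Integrable.of_bound (hC ψ).1.aestronglyMeasurable ‖ψ‖
        (Eventually.of_forall fun x => ψ.norm_coe_le_norm x)
    have i1 : ∫ x, φ x ∂(ν.map ι) ≤ (∫ x, d n x ∂(ν.map ι)) + ε / 2 := by
      have : ∫ x, φ x ∂(ν.map ι) ≤ ∫ x, (d n x + ε / 2) ∂(ν.map ι) := by
        refine integral_mono (hInt φ) ((hInt (d n)).add (integrable_const _)) fun x => ?_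
        have := (abs_le.1 (hpt x)).2
        simp only
        linarith
      rw [integral_add (hInt (d n)) (integrable_const _)] at this
      simpa using this
    have i2 : rhoMu P ρ (μ.map ι) (d n) ≤ rhoMu P ρ (μ.map ι) φ + ε / 2 :=
      rhoMu_le_add hρ hLI _ (hC _) (hC _) fun x => by
        have := (abs_le.1 (hpt x)).1
        linarith
    have e3 : ∫ x, d n x ∂(ν.map ι) = ∫ x, h (n + 1) x ∂ν := by
      rw [hι.integral_map]; rfl
    have e4 : rhoMu P ρ (μ.map ι) (d n) = rhoMu P ρ μ (h (n + 1)) := by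
      rw [rhoMu_comp hLI μ hι.measurable (hC _)]
    rw [e3] at i1
    rw [e4] at i2
    calc ENNReal.ofReal ((∫ x, φ x ∂(ν.map ι)) - rhoMu P ρ (μ.map ι) φ)
        ≤ ENNReal.ofReal (((∫ x, h (n + 1) x ∂ν) - rhoMu P ρ μ (h (n + 1))) + ε) := by
          apply ENNReal.ofReal_le_ofReal; linarith
      _ ≤ ENNReal.ofReal ((∫ x, h (n + 1) x ∂ν) - rhoMu P ρ μ (h (n + 1))) + ENNReal.ofReal ε :=
          ENNReal.ofReal_add_le
      _ ≤ _ := by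
          rw [ENNReal.ofReal_coe_nnreal]
          gcongr
          exact le_iSup (fun n => ENNReal.ofReal ((∫ x, h n x ∂ν) - rhoMu P ρ μ (h n))) (n + 1)
  · exact iSup_le fun n => le_iSup₂_of_le (f := fun (g : F → ℝ) (_ : BddMeas g) =>
      ENNReal.ofReal ((∫ x, g x ∂ν) - rhoMu P ρ μ g)) (h n) (hh n) le_rfl

/-- The pointwise gap functional. -/
def gap {Ω : Type*} [MeasurableSpace Ω] (P : Measure Ω) (ρ : (Ω → ℝ) → ℝ)
    {E F : Type*} [MeasurableSpace E] [MeasurableSpace F]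
    (Kν Kμ : Kernel E F) (f : E × F → ℝ) (x : E) : ℝ :=
  (∫ y, f (x, y) ∂(Kν x)) - rhoMu P ρ (Kμ x) (fun y => f (x, y))

section
variable {E F : Type*} [MeasurableSpace E] [MeasurableSpace F] [StandardBorelSpace F]
    (Kν Kμ : Kernel E F) [IsMarkovKernel Kν] [IsMarkovKernel Kμ]

theorem measurable_int {f : E × F → ℝ} (hf : BddMeas f) :
    Measurable (fun x => ∫ y, f (x, y) ∂(Kν x)) :=
  (hf.1.stronglyMeasurable.integral_kernel_prod_right' (κ := Kν)).measurable

theorem abs_int_le {f : E × F → ℝ} {M : ℝ} (hM : ∀ p, |f p| ≤ M) (x : E) :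
    |∫ y, f (x, y) ∂(Kν x)| ≤ M := by
  have := norm_integral_le_of_norm_le_const (μ := Kν x) (f := fun y => f (x, y)) (C := M)
    (Eventually.of_forall fun y => hM (x, y))
  simpa using this

theorem measurable_gap (hρ : IsRiskMeasure P ρ) (hLI : LawInvariant P ρ)
    {f : E × F → ℝ} (hf : BddMeas f) : Measurable (gap P ρ Kν Kμ f) :=
  (measurable_int Kν hf).sub (measurable_rhoMu hρ hLI Kμ hf)

theorem integral_gap (hρ : IsRiskMeasure P ρ) (hLI : LawInvariant P ρ)
    (ν : Measure E) [IsProbabilityMeasure ν] {f : E × F → ℝ} (hf : BddMeas f) :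
    Integrable (gap P ρ Kν Kμ f) ν ∧
    ∫ x, gap P ρ Kν Kμ f x ∂ν = (∫ p, f p ∂(ν ⊗ₘ Kν)) -
          ∫ x, rhoMu P ρ (Kμ x) (fun y => f (x, y)) ∂ν := by
  obtain ⟨M, hM⟩ := hf.2
  have h1 : Integrable (fun x => ∫ y, f (x, y) ∂(Kν x)) ν :=
    Integrable.of_bound (measurable_int Kν hf).aestronglyMeasurable M
      (Eventually.of_forall fun x => abs_int_le Kν hM x)
  have h2 : Integrable (fun x => rhoMu P ρ (Kμ x) (fun y => f (x, y))) ν :=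
    Integrable.of_bound (measurable_rhoMu hρ hLI Kμ hf).aestronglyMeasurable M
      (Eventually.of_forall fun x => abs_rhoMu_le hρ hLI _ (hf.slice x) fun y => hM (x, y))
  have h3 : Integrable f (ν ⊗ₘ Kν) :=
    Integrable.of_bound hf.1.aestronglyMeasurable M (Eventually.of_forall hM)
  refine ⟨h1.sub h2, ?_⟩
  rw [Measure.integral_compProd h3, ← integral_sub h1 h2]
  rfl

theorem exists_max (hρ : IsRiskMeasure P ρ) (hLI : LawInvariant P ρ)
    (h : ℕ → F → ℝ) (hh : ∀ n, BddMeas (h n)) (N : ℕ) :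
    ∃ f : E × F → ℝ, BddMeas f ∧ ∀ x, ∀ n ≤ N,
      gap P ρ Kν Kμ (fun p => h n p.2) x ≤ gap P ρ Kν Kμ f x := by
  have hh2 : ∀ n, BddMeas (fun p : E × F => h n p.2) := fun n => (hh n).comp measurable_snd
  induction N with
  | zero =>
    refine ⟨_, hh2 0, fun x n hn => ?_⟩
    rw [Nat.le_zero.1 hn]
  | succ N ih =>
    obtain ⟨f, hf, hfN⟩ := ih
    classical
    let A : Set E := {x | gap P ρ Kν Kμ f x < gap P ρ Kν Kμ (fun p => h (N + 1) p.2) x}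
    have hA : MeasurableSet A := measurableSet_lt (measurable_gap Kν Kμ hρ hLI hf)
      (measurable_gap Kν Kμ hρ hLI (hh2 (N + 1)))
    let g : E × F → ℝ := fun p => if p.1 ∈ A then h (N + 1) p.2 else f p
    have hg : BddMeas g := by
      refine ⟨Measurable.ite (measurable_fst hA) (hh2 (N + 1)).1 hf.1, ?_⟩
      obtain ⟨M, hM⟩ := hf.2
      obtain ⟨M', hM'⟩ := (hh2 (N + 1)).2
      refine ⟨max M M', fun p => ?_⟩
      simp only [g]
      split_ifs
      · exact (hM' p).trans (le_max_right _ _)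
      · exact (hM p).trans (le_max_left _ _)
    refine ⟨g, hg, fun x n hn => ?_⟩
    by_cases hx : x ∈ A
    · have e : gap P ρ Kν Kμ g x = gap P ρ Kν Kμ (fun p => h (N + 1) p.2) x := by
        simp [gap, g, hx]
      rw [e]
      rcases Nat.le_succ_iff.1 hn with hn | rfl
      · exact (hfN x n hn).trans (le_of_lt hx)
      · exact le_rfl
    · have e : gap P ρ Kν Kμ g x = gap P ρ Kν Kμ f x := by
        simp [gap, g, hx]
      rw [e]
      rcases Nat.le_succ_iff.1 hn with hn | rfl
      · exact hfN x n hn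
      · exact not_lt.1 hx

end
end

/-- For a law invariant risk measure `ρ` with simplified induced divergence
`α`, kernels `K^ν, K^μ` from `E` to `F` and `ν̄ := ν ⊗ K^ν`, one has the identity in `[0,∞]`:
`∫ ν(dx) α(K^ν_x | K^μ_x) = sup_f (∫ f dν̄ − ∫ ν(dx) ρ_{K^μ_x}(f(x,·)))`, the supremum being
over bounded measurable `f : E × F → ℝ`. -/
theorem statement10 {Ω : Type*} [MeasurableSpace Ω] [StandardBorelSpace Ω]
    (P : Measure Ω) [IsProbabilityMeasure P] [NullSingletonClass P]
    (ρ : (Ω → ℝ) → ℝ) (hρ : IsRiskMeasure P ρ) (hLI : LawInvariant P ρ)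
    (hSimp : Simplified P ρ)
    (E : Type) [TopologicalSpace E] [MeasurableSpace E] [PolishSpace E] [BorelSpace E]
    (F : Type) [TopologicalSpace F] [MeasurableSpace F] [PolishSpace F] [BorelSpace F]
    (ν : Measure E) [IsProbabilityMeasure ν]
    (Kν Kμ : Kernel E F) [IsMarkovKernel Kν] [IsMarkovKernel Kμ] :
    ∫⁻ x, divergence P ρ (Kν x) (Kμ x) ∂ν =
      ⨆ (f : E × F → ℝ) (_ : BddMeas f),
        ENNReal.ofReal ((∫ p, f p ∂(ν ⊗ₘ Kν)) -
          ∫ x, rhoMu P ρ (Kμ x) (fun y => f (x, y)) ∂ν) := by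
  obtain ⟨h, h0, hh, hdiv⟩ := exists_countable_family hρ hLI hSimp F
  have hh2 : ∀ n, BddMeas (fun p : E × F => h n p.2) := fun n => (hh n).comp measurable_snd
  apply le_antisymm
  · have e : ∀ x, divergence P ρ (Kν x) (Kμ x) =
        ⨆ N : ℕ, ⨆ n : ℕ, ⨆ _ : n ≤ N,
          ENNReal.ofReal (gap P ρ Kν Kμ (fun p => h n p.2) x) := by
      intro x
      rw [hdiv (Kν x) (Kμ x) inferInstance inferInstance]
      apply le_antisymm
      · exact iSup_le fun n => le_iSup_of_le n (le_iSup₂_of_le n le_rfl le_rfl)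
      · exact iSup_le fun N => iSup₂_le fun n _ => le_iSup_of_le n le_rfl
    simp only [e]
    rw [lintegral_iSup]
    · refine iSup_le fun N => ?_
      obtain ⟨f, hf, hfN⟩ := exists_max Kν Kμ hρ hLI h hh N
      have hpos : ∀ x, 0 ≤ gap P ρ Kν Kμ f x := by
        intro x
        have h1 := hfN x 0 (Nat.zero_le N)
        have h2 : gap P ρ Kν Kμ (fun p => h 0 p.2) x = 0 := by
          simp only [gap, h0]
          rw [rhoMu_zero hρ hLI]; simp
        linarith
      obtain ⟨hInt, hval⟩ := integral_gap Kν Kμ hρ hLI ν hf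
      refine le_iSup₂_of_le f hf ?_
      rw [← hval, ofReal_integral_eq_lintegral_ofReal hInt (Eventually.of_forall hpos)]
      refine lintegral_mono fun x => iSup₂_le fun n hn => ?_
      exact ENNReal.ofReal_le_ofReal (hfN x n hn)
    · intro N
      exact Measurable.iSup fun n => Measurable.iSup fun _ =>
        (measurable_gap Kν Kμ hρ hLI (hh2 n)).ennreal_ofReal
    · intro N N' hNN x
      exact iSup₂_le fun n hn => le_iSup₂_of_le n (hn.trans hNN) le_rfl
  · refine iSup₂_le fun f hf => ?_
    obtain ⟨hInt, hval⟩ := integral_gap Kν Kμ hρ hLI ν hf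
    rw [← hval]
    calc ENNReal.ofReal (∫ x, gap P ρ Kν Kμ f x ∂ν)
        ≤ ∫⁻ x, ENNReal.ofReal (gap P ρ Kν Kμ f x) ∂ν := by
          refine (ENNReal.ofReal_le_ofReal (integral_mono hInt hInt.pos_part
            fun x => le_max_left _ _)).trans ?_
          rw [ofReal_integral_eq_lintegral_ofReal hInt.pos_part
            (Eventually.of_forall fun x => le_max_right _ _)]
          refine lintegral_mono fun x => ?_
          simp [ENNReal.ofReal_max]
      _ ≤ _ := by
          refine lintegral_mono fun x => ?_
          exact le_iSup₂_of_le (f := fun (g : F → ℝ) (_ : BddMeas g) =>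
            ENNReal.ofReal ((∫ y, g y ∂(Kν x)) - rhoMu P ρ (Kμ x) g))
            (fun y => f (x, y)) (hf.slice x) le_rfl

end RiskDiv
end
end

section
/- Let ℓ : ℝ → ℝ be a loss function and let ρ(X) := inf{c ∈ ℝ : E[ℓ(X − c)] ≤ 1} be the associated shortfall risk measure, which is a law invariant risk measure on L^∞(Ω,𝓕,P). If ℓ is log-subadditive, i.e., ℓ(x+y) ≤ ℓ(x)ℓ(y) for all x, y ∈ ℝ, then the measure acceptance set 𝓐 of ρ is shift-convex, and hence ρ is acceptance consistent. If ℓ is log-superadditive, i.e., ℓ(x+y) ≥ ℓ(x)ℓ(y) for all x, y ∈ ℝ, then the complement 𝓐^c (within the compactly supported probability measures on ℝ) is shift-convex, and hence ρ is rejection consistent. -/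
open MeasureTheory ProbabilityTheory Filter Topology
open scoped ENNReal NNReal

noncomputable section

namespace RiskDiv

/-- `ρ̃`, the map on distributions induced by a law invariant risk measure:
`ρ̃(P ∘ Z⁻¹) = ρ(Z)`. -/
def tildeRho {Ω : Type*} [MeasurableSpace Ω] (P : Measure Ω) (ρ : (Ω → ℝ) → ℝ)
    (m : Measure ℝ) : ℝ :=
  rhoMu P ρ m id

/-- The conditional risk `ρ(X | 𝓖)(ω) := ρ̃(P(X ∈ · | 𝓖)(ω))`, defined through a regular
conditional law of `X` given the sub-σ-field `G`. -/
def condRho {Ω : Type*} [mΩ : MeasurableSpace Ω] [sb : StandardBorelSpace Ω]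
    (P : Measure Ω) [fin : IsFiniteMeasure P] (ρ : (Ω → ℝ) → ℝ)
    (G : MeasurableSpace Ω) (X : Ω → ℝ) (ω : Ω) : ℝ :=
  @tildeRho Ω mΩ P ρ (@Measure.map Ω ℝ mΩ _ X (@condExpKernel Ω mΩ sb P fin G ω))

/-- `ρ` is acceptance consistent if `ρ(X) ≤ ρ(ρ(X|𝓖))` for all `X ∈ L^∞` and sub-σ-fields `𝓖`. -/
def AcceptanceConsistent {Ω : Type*} [mΩ : MeasurableSpace Ω] [sb : StandardBorelSpace Ω]
    (P : Measure Ω) [fin : IsFiniteMeasure P] (ρ : (Ω → ℝ) → ℝ) : Prop :=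
  ∀ X : Ω → ℝ, BddMeas X → ∀ G : MeasurableSpace Ω, G ≤ mΩ →
    ρ X ≤ ρ (@condRho Ω mΩ sb P fin ρ G X)

/-- `ρ` is rejection consistent if `ρ(X) ≥ ρ(ρ(X|𝓖))` for all `X ∈ L^∞` and sub-σ-fields `𝓖`. -/
def RejectionConsistent {Ω : Type*} [mΩ : MeasurableSpace Ω] [sb : StandardBorelSpace Ω]
    (P : Measure Ω) [fin : IsFiniteMeasure P] (ρ : (Ω → ℝ) → ℝ) : Prop :=
  ∀ X : Ω → ℝ, BddMeas X → ∀ G : MeasurableSpace Ω, G ≤ mΩ →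
    ρ (@condRho Ω mΩ sb P fin ρ G X) ≤ ρ X

/-- `ρ` is weakly acceptance consistent if `ρ(X|𝓖) ≤ 0` a.s. implies `ρ(X) ≤ 0`. -/
def WeaklyAcceptanceConsistent {Ω : Type*} [mΩ : MeasurableSpace Ω] [sb : StandardBorelSpace Ω]
    (P : Measure Ω) [fin : IsFiniteMeasure P] (ρ : (Ω → ℝ) → ℝ) : Prop :=
  ∀ X : Ω → ℝ, BddMeas X → ∀ G : MeasurableSpace Ω, G ≤ mΩ →
    (∀ᵐ ω ∂P, @condRho Ω mΩ sb P fin ρ G X ω ≤ 0) → ρ X ≤ 0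

/-- The measure acceptance set `𝓐 = {P ∘ X⁻¹ : X ∈ L^∞, ρ(X) ≤ 0} ⊆ 𝓟(ℝ)`. -/
def acceptanceSet {Ω : Type*} [MeasurableSpace Ω] (P : Measure Ω) (ρ : (Ω → ℝ) → ℝ) :
    Set (Measure ℝ) :=
  {m | ∃ X : Ω → ℝ, BddMeas X ∧ ρ X ≤ 0 ∧ P.map X = m}

/-- A set `A ⊆ 𝓟(ℝ)` is shift-convex if for every `μ ∈ A`, every `M > 0` and every measurable
map `x ↦ K x ∈ A ∩ 𝓟[-M,M]`, the measure `∫ μ(dx) K_x(· − x)` belongs to `A`. -/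
def ShiftConvex (A : Set (Measure ℝ)) : Prop :=
  ∀ μ ∈ A, ∀ M : ℝ, 0 < M → ∀ K : ℝ → Measure ℝ, Measurable K →
    (∀ x : ℝ, K x ∈ A ∧ (K x) (Set.Icc (-M) M)ᶜ = 0) →
    μ.bind (fun x => (K x).map (fun y => y + x)) ∈ A
/-- The shortfall risk measure associated to a loss function `ℓ`:
`ρ(X) := inf {c ∈ ℝ : E[ℓ(X − c)] ≤ 1}`. -/
def shortfall {Ω : Type*} [MeasurableSpace Ω] (P : Measure Ω) (ℓ : ℝ → ℝ)
    (X : Ω → ℝ) : ℝ :=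
  sInf {c : ℝ | ∫ ω, ℓ (X ω - c) ∂P ≤ 1}

/-- The hypotheses on a loss function. -/
structure IsLoss (ℓ : ℝ → ℝ) : Prop where
  conv : ConvexOn ℝ Set.univ ℓ
  mono : Monotone ℓ
  zero : ℓ 0 = 1
  gt : ∀ x : ℝ, 0 < x → 1 < ℓ x

theorem IsLoss.cont {ℓ : ℝ → ℝ} (h : IsLoss ℓ) : Continuous ℓ := by
  rw [← continuousOn_univ]
  exact h.conv.continuousOn isOpen_univ

theorem IsLoss.bound {ℓ : ℝ → ℝ} (h : IsLoss ℓ) {M y c : ℝ} (hy : |y| ≤ M) :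
    |ℓ (y - c)| ≤ max |ℓ (-M - c)| |ℓ (M - c)| := by
  have := abs_le.1 hy
  exact abs_le_max_abs_abs (h.mono (by linarith)) (h.mono (by linarith))

theorem IsLoss.bound' {ℓ : ℝ → ℝ} (h : IsLoss ℓ) {y M : ℝ} (hy : |y| ≤ M) :
    |ℓ y| ≤ max |ℓ (-M)| |ℓ M| := by
  have := abs_le.1 hy
  exact abs_le_max_abs_abs (h.mono (by linarith)) (h.mono (by linarith))

theorem IsLoss.integrable {ℓ : ℝ → ℝ} (h : IsLoss ℓ) {E : Type*} [MeasurableSpace E]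
    {μ : Measure E} [IsFiniteMeasure μ] {f : E → ℝ} (hf : Measurable f) {M : ℝ}
    (hM : ∀ᵐ x ∂μ, |f x| ≤ M) : Integrable (fun x => ℓ (f x)) μ := by
  refine Integrable.of_bound (h.cont.measurable.comp hf).aestronglyMeasurable
    (max |ℓ (-M)| |ℓ M|) ?_
  filter_upwards [hM] with x hx
  exact h.bound' hx

theorem ae_sub_bound {E : Type*} [MeasurableSpace E]
    {μ : Measure E} {f : E → ℝ} {M : ℝ}
    (hM : ∀ᵐ x ∂μ, |f x| ≤ M) (c : ℝ) : ∀ᵐ x ∂μ, |f x - c| ≤ M + |c| := by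
  filter_upwards [hM] with x hx
  exact (abs_sub _ _).trans (by linarith)

theorem IsLoss.integrable_sub {ℓ : ℝ → ℝ} (h : IsLoss ℓ) {E : Type*} [MeasurableSpace E]
    {μ : Measure E} [IsFiniteMeasure μ] {f : E → ℝ} (hf : Measurable f) {M : ℝ}
    (hM : ∀ᵐ x ∂μ, |f x| ≤ M) (c : ℝ) : Integrable (fun x => ℓ (f x - c)) μ :=
  h.integrable (hf.sub_const c) (ae_sub_bound hM c)

section Key

variable {ℓ : ℝ → ℝ} {E : Type*} [MeasurableSpace E]
    {μ : Measure E} [IsProbabilityMeasure μ] {f : E → ℝ} {M : ℝ}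

theorem IsLoss.cont_int (h : IsLoss ℓ) (hf : Measurable f)
    (hM : ∀ᵐ x ∂μ, |f x| ≤ M) : Continuous (fun c => ∫ x, ℓ (f x - c) ∂μ) := by
  rw [continuous_iff_continuousAt]
  intro c
  refine continuousAt_of_dominated
    (bound := fun _ => max |ℓ (-(M + (|c| + 1)))| |ℓ (M + (|c| + 1))|) ?_ ?_ ?_ ?_
  · exact Eventually.of_forall fun d => (h.integrable_sub hf hM d).aestronglyMeasurable
  · have : ∀ᶠ d in 𝓝 c, |d| < |c| + 1 :=
      (continuous_abs.tendsto c).eventually (gt_mem_nhds (by linarith))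
    filter_upwards [this] with d hd
    filter_upwards [hM] with x hx
    apply h.bound'
    exact (abs_sub _ _).trans (by linarith)
  · exact integrable_const _
  · exact Eventually.of_forall fun x => (h.cont.comp (by fun_prop)).continuousAt

theorem IsLoss.anti_int (h : IsLoss ℓ) (hf : Measurable f)
    (hM : ∀ᵐ x ∂μ, |f x| ≤ M) : Antitone (fun c => ∫ x, ℓ (f x - c) ∂μ) := by
  intro c d hcd
  exact integral_mono (h.integrable_sub hf hM d) (h.integrable_sub hf hM c)
    fun x => h.mono (by linarith)

theorem IsLoss.one_lt_int (h : IsLoss ℓ) (hf : Measurable f)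
    (hM : ∀ᵐ x ∂μ, |f x| ≤ M) {c : ℝ} (hc : c < -M) : 1 < ∫ x, ℓ (f x - c) ∂μ := by
  have h1 : 1 < ℓ (-M - c) := h.gt _ (by linarith)
  have h2 : ∫ x, ℓ (-M - c) ∂μ ≤ ∫ x, ℓ (f x - c) ∂μ := by
    refine integral_mono_ae (integrable_const _) (h.integrable_sub hf hM c) ?_
    filter_upwards [hM] with x hx
    exact h.mono (by linarith [(abs_le.1 hx).1])
  simp at h2
  linarith

theorem IsLoss.int_le_one (h : IsLoss ℓ) (hf : Measurable f)
    (hM : ∀ᵐ x ∂μ, |f x| ≤ M) : ∫ x, ℓ (f x - M) ∂μ ≤ 1 := by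
  have h2 : ∫ x, ℓ (f x - M) ∂μ ≤ ∫ x, ℓ 0 ∂μ := by
    refine integral_mono_ae (h.integrable_sub hf hM M) (integrable_const _) ?_
    filter_upwards [hM] with x hx
    exact h.mono (by linarith [(abs_le.1 hx).2])
  simpa [h.zero] using h2

theorem IsLoss.key (h : IsLoss ℓ) (hf : Measurable f)
    (hM : ∀ᵐ x ∂μ, |f x| ≤ M) (c : ℝ) :
    shortfall μ ℓ f ≤ c ↔ ∫ x, ℓ (f x - c) ∂μ ≤ 1 := by
  have hbdd : BddBelow {c : ℝ | ∫ x, ℓ (f x - c) ∂μ ≤ 1} := by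
    refine ⟨-M, fun c hc => ?_⟩
    by_contra! hlt
    exact absurd hc (not_le.2 (h.one_lt_int hf hM hlt))
  constructor
  · intro hc
    have hcl : IsClosed {c : ℝ | ∫ x, ℓ (f x - c) ∂μ ≤ 1} :=
      isClosed_le (h.cont_int hf hM) continuous_const
    have := hcl.csInf_mem ⟨M, h.int_le_one hf hM⟩ hbdd
    exact (h.anti_int hf hM hc).trans this
  · intro hc
    exact csInf_le hbdd hc

theorem IsLoss.key_eq (h : IsLoss ℓ) (hf : Measurable f)
    (hM : ∀ᵐ x ∂μ, |f x| ≤ M) :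
    ∫ x, ℓ (f x - shortfall μ ℓ f) ∂μ = 1 := by
  apply le_antisymm ((h.key hf hM _).1 le_rfl)
  have ht : Tendsto (fun c => ∫ x, ℓ (f x - c) ∂μ) (𝓝[<] (shortfall μ ℓ f))
    (𝓝 (∫ x, ℓ (f x - shortfall μ ℓ f) ∂μ)) :=
    ((h.cont_int hf hM).tendsto _).mono_left nhdsWithin_le_nhds
  refine ge_of_tendsto ht ?_
  filter_upwards [self_mem_nhdsWithin] with c hc
  by_contra! hlt
  exact absurd ((h.key hf hM c).2 hlt.le) (not_le.2 hc)

theorem IsLoss.abs_shortfall (h : IsLoss ℓ) (hf : Measurable f)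
    (hM : ∀ᵐ x ∂μ, |f x| ≤ M) : |shortfall μ ℓ f| ≤ M := by
  rw [abs_le]
  constructor
  · by_contra! hlt
    have := h.one_lt_int hf hM hlt
    linarith [h.key_eq hf hM]
  · exact (h.key hf hM M).2 (h.int_le_one hf hM)

end Key

theorem shortfall_map (ℓ : ℝ → ℝ) (hℓ : Continuous ℓ) {E : Type*} [MeasurableSpace E]
    {μ : Measure E} {f : E → ℝ} (hf : Measurable f) :
    shortfall (μ.map f) ℓ id = shortfall μ ℓ f := by
  unfold shortfall
  congr 1
  ext c
  simp only [id, Set.mem_ofPred_eq]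
  rw [integral_map hf.aemeasurable
    (f := fun y => ℓ (y - c)) (by fun_prop)]

theorem BddMeas.ae {E : Type*} [MeasurableSpace E] {f : E → ℝ} (hf : BddMeas f) (μ : Measure E) :
    ∃ M, ∀ᵐ x ∂μ, |f x| ≤ M := by
  obtain ⟨M, hM⟩ := hf.2
  exact ⟨M, Eventually.of_forall hM⟩

theorem IsLoss.lawInvariant {ℓ : ℝ → ℝ} (h : IsLoss ℓ) {E : Type*} [MeasurableSpace E]
    (μ : Measure E) : LawInvariant μ (shortfall μ ℓ) := by
  intro f g hf hg hfg
  rw [← shortfall_map ℓ h.cont hf.1, hfg, shortfall_map ℓ h.cont hg.1]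

theorem IsLoss.isRiskMeasure {ℓ : ℝ → ℝ} (h : IsLoss ℓ) {E : Type*} [MeasurableSpace E]
    (μ : Measure E) [IsProbabilityMeasure μ] : IsRiskMeasure μ (shortfall μ ℓ) := by
  have hmono : ∀ f g : E → ℝ, BddMeas f → BddMeas g → (∀ᵐ x ∂μ, f x ≤ g x) →
      shortfall μ ℓ f ≤ shortfall μ ℓ g := by
    intro f g hf hg hfg
    obtain ⟨M, hM⟩ := hf.ae μ
    obtain ⟨N, hN⟩ := hg.ae μ
    rw [h.key hf.1 hM, ← h.key_eq hg.1 hN]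
    refine integral_mono_ae (h.integrable_sub hf.1 hM _) (h.integrable_sub hg.1 hN _) ?_
    filter_upwards [hfg] with x hx
    exact h.mono (by linarith)
  refine ⟨hmono, ?_, ?_, ?_, ?_⟩
  · intro f a hf
    obtain ⟨M, hM⟩ := hf.ae μ
    refine eq_of_forall_ge_iff fun c => ?_
    have hM' : ∀ᵐ x ∂μ, |f x + a| ≤ M + |a| := by
      filter_upwards [hM] with x hx
      exact (abs_add_le _ _).trans (by linarith)
    rw [h.key (hf.1.add_const a) hM', ← le_sub_iff_add_le, h.key hf.1 hM]
    simp only [sub_sub_eq_add_sub]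
  · refine eq_of_forall_ge_iff fun c => ?_
    rw [h.key (M := 0) measurable_const (by simp)]
    simp only [zero_sub, integral_const, probReal_univ, smul_eq_mul, one_mul]
    constructor
    · intro hc
      by_contra! hlt
      linarith [h.gt (-c) (by linarith)]
    · intro hc
      rw [← h.zero]
      exact h.mono (by linarith)
  · intro f g t hf hg ht0 ht1
    obtain ⟨M, hM⟩ := hf.ae μ
    obtain ⟨N, hN⟩ := hg.ae μ
    have hM' : ∀ᵐ x ∂μ, |t * f x + (1 - t) * g x| ≤ t * M + (1 - t) * N := by
      filter_upwards [hM, hN] with x hx hy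
      refine (abs_add_le _ _).trans ?_
      rw [abs_mul, abs_mul, abs_of_nonneg ht0, abs_of_nonneg (sub_nonneg.2 ht1)]
      have : 0 ≤ 1 - t := by linarith
      gcongr
    have hmeas : Measurable fun x => t * f x + (1 - t) * g x :=
      (hf.1.const_mul t).add (hg.1.const_mul _)
    rw [h.key hmeas hM']
    have hi1 := (h.integrable_sub hf.1 hM (shortfall μ ℓ f)).const_mul t
    have hi2 := (h.integrable_sub hg.1 hN (shortfall μ ℓ g)).const_mul (1 - t)
    calc _ ≤ ∫ x, (t * ℓ (f x - shortfall μ ℓ f) + (1 - t) * ℓ (g x - shortfall μ ℓ g)) ∂μ := by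
          refine integral_mono (h.integrable_sub hmeas hM' _) (hi1.add hi2) fun x => ?_
          have := h.conv.2 (Set.mem_univ (f x - shortfall μ ℓ f))
            (Set.mem_univ (g x - shortfall μ ℓ g)) ht0 (sub_nonneg.2 ht1) (by ring)
          simp only [smul_eq_mul] at this
          refine le_trans (le_of_eq ?_) this
          congr 1
          ring
      _ = 1 := by
          rw [integral_add hi1 hi2, integral_const_mul, integral_const_mul,
            h.key_eq hf.1 hM, h.key_eq hg.1 hN]
          ring
      _ ≤ 1 := le_rfl
  · intro f g hf hg hfg
    exact le_antisymm (hmono f g hf hg (hfg.mono fun x hx => hx.le))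
      (hmono g f hg hf (hfg.mono fun x hx => hx.ge))

theorem continuous_cdf (ν : Measure ℝ) [IsProbabilityMeasure ν] [NullSingletonClass ν] :
    Continuous (cdf ν) := by
  rw [continuous_iff_continuousAt]
  intro a
  have h1 := (cdf ν).measure_singleton a
  rw [measure_cdf, measure_singleton] at h1
  have h2 : cdf ν a ≤ Function.leftLim (cdf ν) a := by
    have := ENNReal.ofReal_eq_zero.1 h1.symm
    linarith
  rw [(monotone_cdf ν).continuousAt_iff_leftLim_eq_rightLim, (cdf ν).rightLim_eq]
  exact le_antisymm ((monotone_cdf ν).leftLim_le le_rfl) h2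

theorem measure_cdf_le (ν : Measure ℝ) [IsProbabilityMeasure ν] [NullSingletonClass ν]
    {t : ℝ} (ht0 : 0 ≤ t) (ht1 : t ≤ 1) : ν {x | cdf ν x ≤ t} = ENNReal.ofReal t := by
  rcases ht1.eq_or_lt with rfl | ht1
  · have : {x | cdf ν x ≤ 1} = Set.univ := by
      ext x; simp [cdf_le_one]
    simp [this]
  have hcl : IsClosed {x | cdf ν x ≤ t} := isClosed_le (continuous_cdf ν) continuous_const
  rcases Set.eq_empty_or_nonempty {x | cdf ν x ≤ t} with he | hne
  · have : t = 0 := by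
      by_contra hne
      have hpos : 0 < t := lt_of_le_of_ne ht0 (Ne.symm hne)
      obtain ⟨x, hx⟩ := ((tendsto_cdf_atBot ν).eventually (gt_mem_nhds hpos)).exists
      have : x ∈ {x | cdf ν x ≤ t} := hx.le
      simp [he] at this
    rw [he]; simp [this]
  · obtain ⟨b, hb⟩ := ((tendsto_cdf_atTop ν).eventually (lt_mem_nhds ht1)).exists
    have hbdd : BddAbove {x | cdf ν x ≤ t} := by
      refine ⟨b, fun x hx => ?_⟩
      by_contra! hlt
      have := monotone_cdf ν hlt.le
      have hx' : cdf ν x ≤ t := hx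
      linarith
    set s := sSup {x | cdf ν x ≤ t} with hs
    have hmem : cdf ν s ≤ t := hcl.csSup_mem hne hbdd
    have hge : t ≤ cdf ν s := by
      have htend : Tendsto (cdf ν) (𝓝[>] s) (𝓝 (cdf ν s)) :=
        ((continuous_cdf ν).tendsto s).mono_left nhdsWithin_le_nhds
      refine ge_of_tendsto htend ?_
      filter_upwards [self_mem_nhdsWithin] with y hy
      by_contra! hlt
      exact absurd (le_csSup hbdd (show y ∈ {x | cdf ν x ≤ t} from hlt.le)) (not_le.2 hy)
    have hset : {x | cdf ν x ≤ t} = Set.Iic s := by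
      ext x
      exact ⟨fun hx => le_csSup hbdd hx, fun hx => (monotone_cdf ν hx).trans hmem⟩
    rw [hset, ← ofReal_cdf, le_antisymm hmem hge]

theorem exists_law {Ω : Type*} [MeasurableSpace Ω] [StandardBorelSpace Ω]
    (P : Measure Ω) [IsProbabilityMeasure P] [NullSingletonClass P]
    (m : Measure ℝ) [IsProbabilityMeasure m] : ∃ X : Ω → ℝ, Measurable X ∧ P.map X = m := by
  obtain ⟨U, hU, hU'⟩ := exists_uniform P
  obtain ⟨f, hf, hf'⟩ := Measure.exists_measurable_map_eq m
  exact ⟨f ∘ U, hf.comp hU, by rw [← Measure.map_map hf hU, hU', hf']⟩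

section Shift

variable {μ : Measure ℝ} [IsProbabilityMeasure μ] {N M : ℝ}

theorem bind_eq_map (κ : Kernel ℝ ℝ) [IsMarkovKernel κ] :
    μ.bind (fun x => (κ x).map (fun y => y + x)) =
      (μ ⊗ₘ κ).map (fun p : ℝ × ℝ => p.2 + p.1) := by
  have hg : Measurable (fun p : ℝ × ℝ => p.2 + p.1) := by fun_prop
  have hη : (fun x => (κ x).map (fun y => y + x)) =
      ((Kernel.id ×ₖ κ).map (fun p : ℝ × ℝ => p.2 + p.1)) := by
    funext x
    rw [Kernel.map_apply _ hg, Kernel.prod_apply, Kernel.id_apply, Measure.dirac_prod,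
      Measure.map_map hg (by fun_prop)]
    rfl
  have hm : Measurable (fun x => (κ x).map (fun y => y + x)) := by
    rw [hη]
    exact Kernel.measurable _
  ext s hs
  rw [Measure.bind_apply hs hm.aemeasurable, Measure.map_apply hg hs,
    Measure.compProd_apply (hg hs)]
  refine lintegral_congr fun x => ?_
  rw [Measure.map_apply (by fun_prop) hs]
  rfl

theorem ae_compProd_bound (κ : Kernel ℝ ℝ) [IsMarkovKernel κ]
    (hN : ∀ᵐ x ∂μ, |x| ≤ N) (hM : ∀ x, ∀ᵐ y ∂(κ x), |y| ≤ M) :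
    ∀ᵐ p ∂(μ ⊗ₘ κ), |p.2 + p.1| ≤ M + N := by
  refine Measure.ae_compProd_of_ae_ae ?_ ?_
  · exact measurableSet_le (by fun_prop) measurable_const
  · filter_upwards [hN] with x hx
    filter_upwards [hM x] with y hy
    exact (abs_add_le _ _).trans (by linarith)

end Shift

theorem ae_of_compl_zero {m : Measure ℝ} {M : ℝ} (h : m (Set.Icc (-M) M)ᶜ = 0) :
    ∀ᵐ x ∂m, |x| ≤ M := by
  rw [ae_iff]
  convert h using 2
  ext x
  simp [abs_le]

theorem compl_zero_of_ae {m : Measure ℝ} {M : ℝ} (h : ∀ᵐ x ∂m, |x| ≤ M) :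
    m (Set.Icc (-M) M)ᶜ = 0 := by
  rw [ae_iff] at h
  convert h using 2
  ext x
  simp [abs_le]

section Main

variable {Ω : Type*}

theorem IsLoss.mem_acc {ℓ : ℝ → ℝ} (h : IsLoss ℓ) [MeasurableSpace Ω] [StandardBorelSpace Ω]
    (P : Measure Ω) [IsProbabilityMeasure P] [NullSingletonClass P] (m : Measure ℝ) :
    m ∈ acceptanceSet P (shortfall P ℓ) ↔
      IsProbabilityMeasure m ∧ (∃ M, ∀ᵐ x ∂m, |x| ≤ M) ∧ ∫ x, ℓ x ∂m ≤ 1 := by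
  constructor
  · rintro ⟨X, hX, hle, rfl⟩
    obtain ⟨M, hM⟩ := hX.2
    refine ⟨Measure.isProbabilityMeasure_map hX.1.aemeasurable, ⟨M, ?_⟩, ?_⟩
    · rw [ae_map_iff hX.1.aemeasurable (measurableSet_le (by fun_prop) measurable_const)]
      exact Eventually.of_forall hM
    · rw [h.key hX.1 (Eventually.of_forall hM)] at hle
      rw [integral_map hX.1.aemeasurable h.cont.aestronglyMeasurable]
      simpa using hle
  · rintro ⟨hm, ⟨M, hM⟩, hle⟩
    obtain ⟨X, hX, rfl⟩ := exists_law P m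
    have hM' : ∀ᵐ ω ∂P, |X ω| ≤ M := ae_of_ae_map hX.aemeasurable hM
    have hae : (fun ω => max (-|M|) (min |M| (X ω))) =ᵐ[P] X := by
      filter_upwards [hM'] with ω hω
      have h1 := abs_le.1 (hω.trans (le_abs_self M))
      rw [min_eq_right h1.2, max_eq_right h1.1]
    have hX' : Measurable (fun ω => max (-|M|) (min |M| (X ω))) := by fun_prop
    have hb : ∀ ω, |max (-|M|) (min |M| (X ω))| ≤ |M| := fun ω => by
      rw [abs_le]
      exact ⟨le_max_left _ _, max_le (by linarith [abs_nonneg M]) (min_le_left _ _)⟩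
    refine ⟨fun ω => max (-|M|) (min |M| (X ω)), ⟨hX', |M|, hb⟩, ?_, Measure.map_congr hae⟩
    rw [h.key hX' (Eventually.of_forall hb)]
    rw [integral_map hX.aemeasurable h.cont.aestronglyMeasurable] at hle
    refine le_trans (le_of_eq (integral_congr_ae ?_)) hle
    filter_upwards [hae] with ω hω
    rw [sub_zero]
    exact congrArg ℓ hω

theorem IsLoss.shift_core {ℓ : ℝ → ℝ} (h : IsLoss ℓ) {μ : Measure ℝ} [IsProbabilityMeasure μ]
    {N M : ℝ} {K : ℝ → Measure ℝ} (hK : Measurable K) [∀ x, IsProbabilityMeasure (K x)]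
    (hN : ∀ᵐ x ∂μ, |x| ≤ N) (hM : ∀ x, ∀ᵐ y ∂(K x), |y| ≤ M) :
    IsProbabilityMeasure (μ.bind (fun x => (K x).map (fun y => y + x))) ∧
    (∀ᵐ z ∂(μ.bind (fun x => (K x).map (fun y => y + x))), |z| ≤ M + N) ∧
    Integrable (fun x => ∫ y, ℓ (y + x) ∂(K x)) μ ∧
    ∫ z, ℓ z ∂(μ.bind (fun x => (K x).map (fun y => y + x))) =
      ∫ x, ∫ y, ℓ (y + x) ∂(K x) ∂μ := by
  let κ : Kernel ℝ ℝ := ⟨K, hK⟩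
  have : IsMarkovKernel κ := ⟨fun x => inferInstanceAs (IsProbabilityMeasure (K x))⟩
  have hg : Measurable (fun p : ℝ × ℝ => p.2 + p.1) := by fun_prop
  have heq := bind_eq_map (μ := μ) κ
  have hb := ae_compProd_bound (μ := μ) κ hN hM
  change μ.bind (fun x => (K x).map (fun y => y + x)) = _ at heq
  rw [heq]
  have hint : Integrable (fun p : ℝ × ℝ => ℓ (p.2 + p.1)) (μ ⊗ₘ κ) := h.integrable hg hb
  refine ⟨Measure.isProbabilityMeasure_map hg.aemeasurable, ?_, ?_, ?_⟩
  · rw [ae_map_iff hg.aemeasurable (measurableSet_le (by fun_prop) measurable_const)]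
    exact hb
  · exact MeasureTheory.Integrable.integral_compProd (κ := Kernel.const Unit μ)
      (η := Kernel.prodMkLeft Unit κ) (a := ()) hint
  · rw [integral_map hg.aemeasurable h.cont.aestronglyMeasurable, Measure.integral_compProd hint]
    rfl

theorem IsLoss.integrable_add {ℓ : ℝ → ℝ} (h : IsLoss ℓ) {m : Measure ℝ} [IsProbabilityMeasure m]
    {M : ℝ} (hM : ∀ᵐ y ∂m, |y| ≤ M) (x : ℝ) : Integrable (fun y => ℓ (y + x)) m := by
  have := h.integrable_sub measurable_id hM (-x)
  simpa using this

theorem IsLoss.integrable_id {ℓ : ℝ → ℝ} (h : IsLoss ℓ) {m : Measure ℝ} [IsProbabilityMeasure m]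
    {M : ℝ} (hM : ∀ᵐ y ∂m, |y| ≤ M) : Integrable (fun y => ℓ y) m := by
  have := h.integrable measurable_id hM
  simpa using this

theorem IsLoss.nonneg_sub {ℓ : ℝ → ℝ} (h : IsLoss ℓ)
    (hs : ∀ x y : ℝ, ℓ (x + y) ≤ ℓ x * ℓ y) (x : ℝ) : 0 ≤ ℓ x := by
  rcases le_total 0 x with hx | hx
  · have := h.mono hx
    rw [h.zero] at this
    linarith
  · by_contra! hneg
    have h1 := hs x (-x)
    rw [add_neg_cancel, h.zero] at h1
    have h2 := h.mono (show 0 ≤ -x by linarith)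
    rw [h.zero] at h2
    nlinarith

theorem IsLoss.nonneg_super {ℓ : ℝ → ℝ} (h : IsLoss ℓ)
    (hs : ∀ x y : ℝ, ℓ x * ℓ y ≤ ℓ (x + y)) (x : ℝ) : 0 ≤ ℓ x := by
  rcases le_total 0 x with hx | hx
  · have := h.mono hx
    rw [h.zero] at this
    linarith
  · by_contra! hneg
    have h1 := hs x x
    have h2 := h.mono (show x + x ≤ x by linarith)
    nlinarith

theorem IsLoss.shift_sub {ℓ : ℝ → ℝ} (h : IsLoss ℓ)
    (hs : ∀ x y : ℝ, ℓ (x + y) ≤ ℓ x * ℓ y) [MeasurableSpace Ω] [StandardBorelSpace Ω]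
    (P : Measure Ω) [IsProbabilityMeasure P] [NullSingletonClass P] :
    ShiftConvex (acceptanceSet P (shortfall P ℓ)) := by
  intro μ hμ M _ K hK hKA
  obtain ⟨hμp, ⟨N, hN⟩, hμ1⟩ := (h.mem_acc P μ).1 hμ
  have hKA' := fun x => (h.mem_acc P (K x)).1 (hKA x).1
  have : ∀ x, IsProbabilityMeasure (K x) := fun x => (hKA' x).1
  have hM : ∀ x, ∀ᵐ y ∂(K x), |y| ≤ M := fun x => ae_of_compl_zero (hKA x).2
  obtain ⟨h1, h2, h3, h4⟩ := h.shift_core hK hN hM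
  refine (h.mem_acc P _).2 ⟨h1, ⟨_, h2⟩, ?_⟩
  rw [h4]
  refine (integral_mono h3 (h.integrable_id hN) fun x => ?_).trans hμ1
  calc ∫ y, ℓ (y + x) ∂(K x) ≤ ∫ y, ℓ y * ℓ x ∂(K x) :=
        integral_mono (h.integrable_add (hM x) x) ((h.integrable_id (hM x)).mul_const _)
          fun y => hs y x
    _ = (∫ y, ℓ y ∂(K x)) * ℓ x := integral_mul_const _ _
    _ ≤ 1 * ℓ x := mul_le_mul_of_nonneg_right (hKA' x).2.2 (h.nonneg_sub hs x)
    _ = ℓ x := one_mul _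

theorem IsLoss.shift_super {ℓ : ℝ → ℝ} (h : IsLoss ℓ)
    (hs : ∀ x y : ℝ, ℓ x * ℓ y ≤ ℓ (x + y)) [MeasurableSpace Ω] [StandardBorelSpace Ω]
    (P : Measure Ω) [IsProbabilityMeasure P] [NullSingletonClass P] :
    ShiftConvex {m : Measure ℝ | IsProbabilityMeasure m ∧
          (∃ M : ℝ, m (Set.Icc (-M) M)ᶜ = 0) ∧
          m ∉ acceptanceSet P (shortfall P ℓ)} := by
  rintro μ ⟨hμp, ⟨N, hN⟩, hμ1⟩ M _ K hK hKA
  replace hN := ae_of_compl_zero hN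
  have : ∀ x, IsProbabilityMeasure (K x) := fun x => (hKA x).1.1
  have hM : ∀ x, ∀ᵐ y ∂(K x), |y| ≤ M := fun x => ae_of_compl_zero (hKA x).2
  have hμ1' : 1 < ∫ x, ℓ x ∂μ := by
    by_contra! hle
    exact hμ1 ((h.mem_acc P μ).2 ⟨hμp, ⟨N, hN⟩, hle⟩)
  have hK1 : ∀ x, 1 < ∫ y, ℓ y ∂(K x) := fun x => by
    by_contra! hle
    exact (hKA x).1.2.2 ((h.mem_acc P (K x)).2 ⟨this x, ⟨M, hM x⟩, hle⟩)
  obtain ⟨h1, h2, h3, h4⟩ := h.shift_core hK hN hM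
  refine ⟨h1, ⟨_, compl_zero_of_ae h2⟩, fun hmem => ?_⟩
  have hle := ((h.mem_acc P _).1 hmem).2.2
  rw [h4] at hle
  refine absurd (hμ1'.trans_le (integral_mono (h.integrable_id hN) h3 fun x => ?_)) (not_lt.2 hle)
  calc ℓ x = 1 * ℓ x := (one_mul _).symm
    _ ≤ (∫ y, ℓ y ∂(K x)) * ℓ x := mul_le_mul_of_nonneg_right (hK1 x).le (h.nonneg_super hs x)
    _ = ∫ y, ℓ y * ℓ x ∂(K x) := (integral_mul_const _ _).symm
    _ ≤ ∫ y, ℓ (y + x) ∂(K x) :=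
        integral_mono ((h.integrable_id (hM x)).mul_const _) (h.integrable_add (hM x) x)
          fun y => hs y x

theorem IsLoss.tilde {ℓ : ℝ → ℝ} (h : IsLoss ℓ) [MeasurableSpace Ω] [StandardBorelSpace Ω]
    (P : Measure Ω) [IsProbabilityMeasure P] [NullSingletonClass P]
    (m : Measure ℝ) [IsProbabilityMeasure m] :
    tildeRho P (shortfall P ℓ) m = shortfall m ℓ id := by
  have hex := exists_law P m
  unfold tildeRho rhoMu
  rw [dif_pos hex, Function.id_comp, ← shortfall_map ℓ h.cont hex.choose_spec.1,
    hex.choose_spec.2]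

theorem IsLoss.condRho_eq {ℓ : ℝ → ℝ} (h : IsLoss ℓ) {G : MeasurableSpace Ω}
    [mΩ : MeasurableSpace Ω] [StandardBorelSpace Ω]
    (P : Measure Ω) [IsProbabilityMeasure P] [NullSingletonClass P]
    {X : Ω → ℝ} (hX : Measurable X) (ω : Ω) :
    condRho P (shortfall P ℓ) G X ω = shortfall (condExpKernel P G ω) ℓ X := by
  unfold condRho
  have := Measure.isProbabilityMeasure_map (μ := condExpKernel P G ω) hX.aemeasurable
  rw [h.tilde, shortfall_map ℓ h.cont hX]

theorem IsLoss.cond_core {ℓ : ℝ → ℝ} (h : IsLoss ℓ) {G : MeasurableSpace Ω}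
    [mΩ : MeasurableSpace Ω] [StandardBorelSpace Ω] (hG : G ≤ mΩ)
    (P : Measure Ω) [IsProbabilityMeasure P] [NullSingletonClass P]
    {X : Ω → ℝ} (hX : Measurable X) {M : ℝ} (hM : ∀ ω, |X ω| ≤ M) :
    Measurable (condRho P (shortfall P ℓ) G X) ∧
    (∀ ω, |condRho P (shortfall P ℓ) G X ω| ≤ M) ∧
    (∀ ω, ∫ y, ℓ (X y - condRho P (shortfall P ℓ) G X ω) ∂(condExpKernel P G ω) = 1) ∧
    (∀ c, Integrable (fun ω => ∫ y, ℓ (X y - c) ∂(condExpKernel P G ω)) P) ∧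
    (∀ c, ∫ ω, ∫ y, ℓ (X y - c) ∂(condExpKernel P G ω) ∂P = ∫ ω, ℓ (X ω - c) ∂P) := by
  have hm : ∀ c, Measurable (fun ω => ℓ (X ω - c)) := fun c =>
    h.cont.measurable.comp (hX.sub_const c)
  have hi : ∀ c, Integrable (fun ω => ℓ (X ω - c)) P := fun c =>
    h.integrable_sub hX (Eventually.of_forall hM) c
  refine ⟨?_, ?_, ?_, ?_, ?_⟩
  · refine measurable_of_Iic fun c => ?_
    have : condRho P (shortfall P ℓ) G X ⁻¹' Set.Iic c =
        {ω | ∫ y, ℓ (X y - c) ∂(condExpKernel P G ω) ≤ 1} := by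
      ext ω
      simp only [Set.mem_preimage, Set.mem_Iic, Set.mem_ofPred_eq]
      rw [h.condRho_eq P hX, h.key hX (Eventually.of_forall hM)]
    rw [this]
    exact measurableSet_le
      (((hm c).stronglyMeasurable.integral_condExpKernel (μ := P) (m := G)).mono hG).measurable
      measurable_const
  · intro ω
    rw [h.condRho_eq P hX]
    exact h.abs_shortfall hX (Eventually.of_forall hM)
  · intro ω
    rw [h.condRho_eq P hX]
    exact h.key_eq hX (Eventually.of_forall hM)
  · intro c
    exact (hi c).integral_condExpKernel
  · intro c
    rw [← integral_condExp (f := fun ω => ℓ (X ω - c)) hG]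
    exact (integral_congr_ae (condExp_ae_eq_integral_condExpKernel hG (hi c))).symm

theorem IsLoss.acceptance_aux {ℓ : ℝ → ℝ} (h : IsLoss ℓ)
    (hs : ∀ x y : ℝ, ℓ (x + y) ≤ ℓ x * ℓ y) {G : MeasurableSpace Ω}
    {mΩ : MeasurableSpace Ω} [StandardBorelSpace Ω]
    (P : Measure Ω) [IsProbabilityMeasure P] [NullSingletonClass P]
    (hG : G ≤ mΩ) {X : Ω → ℝ} (hXb : BddMeas X) :
    shortfall P ℓ X ≤ shortfall P ℓ (condRho P (shortfall P ℓ) G X) := by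
  obtain ⟨hX, M, hM⟩ := hXb
  obtain ⟨h1, h2, h3, h4, h5⟩ := h.cond_core hG P hX hM
  rw [h.key hX (Eventually.of_forall hM), ← h5,
    ← h.key_eq (μ := P) h1 (Eventually.of_forall h2)]
  refine integral_mono (h4 _) (h.integrable_sub h1 (Eventually.of_forall h2) _) fun ω => ?_
  set Y := @condRho Ω mΩ _ P _ (shortfall P ℓ) G X
  set c := shortfall P ℓ Y
  calc _ ≤ ∫ y, ℓ (X y - Y ω) * ℓ (Y ω - c) ∂(@condExpKernel Ω mΩ _ P _ G ω) := by
        refine integral_mono (h.integrable_sub hX (Eventually.of_forall hM) _)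
          ((h.integrable_sub hX (Eventually.of_forall hM) _).mul_const _) fun y => ?_
        refine le_trans (le_of_eq ?_) (hs _ _)
        congr 1
        ring
    _ = ℓ (Y ω - c) := by rw [integral_mul_const, h3, one_mul]

theorem IsLoss.acceptance {ℓ : ℝ → ℝ} (h : IsLoss ℓ)
    (hs : ∀ x y : ℝ, ℓ (x + y) ≤ ℓ x * ℓ y) [mΩ : MeasurableSpace Ω] [StandardBorelSpace Ω]
    (P : Measure Ω) [IsProbabilityMeasure P] [NullSingletonClass P] :
    AcceptanceConsistent P (shortfall P ℓ) := by
  intro X hX G hG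
  exact h.acceptance_aux hs P hG hX

theorem IsLoss.rejection_aux {ℓ : ℝ → ℝ} (h : IsLoss ℓ)
    (hs : ∀ x y : ℝ, ℓ x * ℓ y ≤ ℓ (x + y)) {G : MeasurableSpace Ω}
    {mΩ : MeasurableSpace Ω} [StandardBorelSpace Ω]
    (P : Measure Ω) [IsProbabilityMeasure P] [NullSingletonClass P]
    (hG : G ≤ mΩ) {X : Ω → ℝ} (hXb : BddMeas X) :
    shortfall P ℓ (condRho P (shortfall P ℓ) G X) ≤ shortfall P ℓ X := by
  obtain ⟨hX, M, hM⟩ := hXb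
  obtain ⟨h1, h2, h3, h4, h5⟩ := h.cond_core hG P hX hM
  rw [h.key h1 (Eventually.of_forall h2), ← h.key_eq (μ := P) hX (Eventually.of_forall hM),
    ← h5]
  refine integral_mono (h.integrable_sub h1 (Eventually.of_forall h2) _) (h4 _) fun ω => ?_
  set Y := @condRho Ω mΩ _ P _ (shortfall P ℓ) G X
  set c := shortfall P ℓ X
  calc ℓ (Y ω - c) = ∫ y, ℓ (X y - Y ω) * ℓ (Y ω - c) ∂(@condExpKernel Ω mΩ _ P _ G ω) := by
        rw [integral_mul_const, h3, one_mul]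
    _ ≤ _ := by
        refine integral_mono ((h.integrable_sub hX (Eventually.of_forall hM) _).mul_const _)
          (h.integrable_sub hX (Eventually.of_forall hM) _) fun y => ?_
        refine le_trans (hs _ _) (le_of_eq ?_)
        congr 1
        ring

theorem IsLoss.rejection {ℓ : ℝ → ℝ} (h : IsLoss ℓ)
    (hs : ∀ x y : ℝ, ℓ x * ℓ y ≤ ℓ (x + y)) [mΩ : MeasurableSpace Ω] [StandardBorelSpace Ω]
    (P : Measure Ω) [IsProbabilityMeasure P] [NullSingletonClass P] :
    RejectionConsistent P (shortfall P ℓ) := by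
  intro X hX G hG
  exact h.rejection_aux hs P hG hX

end Main

/-- The shortfall risk measure associated to a loss function `ℓ` is a law
invariant risk measure; if `ℓ` is log-subadditive, then its measure acceptance set is
shift-convex and it is acceptance consistent, while if `ℓ` is log-superadditive, then the
complement of its measure acceptance set (within the compactly supported probability measures
on `ℝ`) is shift-convex and it is rejection consistent. -/
theorem statement18 {Ω : Type*} [mΩ : MeasurableSpace Ω] [StandardBorelSpace Ω]
    (P : Measure Ω) [IsProbabilityMeasure P] [NullSingletonClass P]
    (ℓ : ℝ → ℝ) (hconv : ConvexOn ℝ Set.univ ℓ) (hmono : Monotone ℓ)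
    (h0 : ℓ 0 = 1) (hgt : ∀ x : ℝ, 0 < x → 1 < ℓ x) :
    (IsRiskMeasure P (shortfall P ℓ) ∧ LawInvariant P (shortfall P ℓ)) ∧
    ((∀ x y : ℝ, ℓ (x + y) ≤ ℓ x * ℓ y) →
      ShiftConvex (acceptanceSet P (shortfall P ℓ)) ∧
        AcceptanceConsistent P (shortfall P ℓ)) ∧
    ((∀ x y : ℝ, ℓ x * ℓ y ≤ ℓ (x + y)) →
      ShiftConvex {m : Measure ℝ | IsProbabilityMeasure m ∧
          (∃ M : ℝ, m (Set.Icc (-M) M)ᶜ = 0) ∧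
          m ∉ acceptanceSet P (shortfall P ℓ)} ∧
        RejectionConsistent P (shortfall P ℓ)) := by
  have h : IsLoss ℓ := ⟨hconv, hmono, h0, hgt⟩
  exact ⟨⟨h.isRiskMeasure P, h.lawInvariant P⟩,
    fun hs => ⟨h.shift_sub hs P, h.acceptance hs P⟩,
    fun hs => ⟨h.shift_super hs P, h.rejection hs P⟩⟩

end RiskDiv
end
end
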